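/- If a two-dimensional complex Finsler metric on D is Kähler and purely Hermitian and the horizontal curvature invariant K is constant on D, then R_{r̄jh̄k} = (K/2)·(g_{jr̄}·g_{kh̄} + g_{kr̄}·g_{jh̄}) at every point of D and for all indices r,j,h,k; consequently the horizontal holomorphic sectional curvatures in directions λ and μ both equal 2K. -/

import Mathlib

open Complex

noncomputable section

namespace CFinsler

/-- A point of `T'M` in local coordinates: `(z, η) ∈ ℂⁿ × ℂⁿ`. -/
abbrev Pt (n : ℕ) := (Fin n → ℂ) × (Fin n → ℂ)

variable {n : ℕ}

/-- Wirtinger derivative `∂f/∂z^k`. -/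
def dz (f : Pt n → ℂ) (k : Fin n) (p : Pt n) : ℂ :=
  (1 / 2) * (fderiv ℝ f p ((Pi.single k 1 : Fin n → ℂ), 0) -
    Complex.I * fderiv ℝ f p ((Pi.single k Complex.I : Fin n → ℂ), 0))

/-- Wirtinger derivative `∂f/∂z̄^k`. -/
def dzbar (f : Pt n → ℂ) (k : Fin n) (p : Pt n) : ℂ :=
  (1 / 2) * (fderiv ℝ f p ((Pi.single k 1 : Fin n → ℂ), 0) +
    Complex.I * fderiv ℝ f p ((Pi.single k Complex.I : Fin n → ℂ), 0))

/-- Wirtinger derivative `∂f/∂η^k`. -/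
def de (f : Pt n → ℂ) (k : Fin n) (p : Pt n) : ℂ :=
  (1 / 2) * (fderiv ℝ f p (0, (Pi.single k 1 : Fin n → ℂ)) -
    Complex.I * fderiv ℝ f p (0, (Pi.single k Complex.I : Fin n → ℂ)))

/-- Wirtinger derivative `∂f/∂η̄^k`. -/
def debar (f : Pt n → ℂ) (k : Fin n) (p : Pt n) : ℂ :=
  (1 / 2) * (fderiv ℝ f p (0, (Pi.single k 1 : Fin n → ℂ)) +
    Complex.I * fderiv ℝ f p (0, (Pi.single k Complex.I : Fin n → ℂ)))

/-- The fundamental metric tensor `g_{i j̄} := ∂²L/∂η^i ∂η̄^j`. -/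
def gm (L : Pt n → ℂ) (i j : Fin n) : Pt n → ℂ := de (debar L j) i

/-- `L` is an `n`-dimensional complex Finsler metric on `D`. -/
structure IsCFM (n : ℕ) (D : Set (Pt n)) (L : Pt n → ℂ) : Prop where
  openD : IsOpen D
  fiber_ne : ∀ p ∈ D, p.2 ≠ 0
  conic : ∀ p ∈ D, ∀ lam : ℂ, lam ≠ 0 → (p.1, lam • p.2) ∈ D
  smooth : ContDiffOn ℝ (⊤ : ℕ∞) L D
  real_im : ∀ p ∈ D, (L p).im = 0
  pos : ∀ p ∈ D, 0 < (L p).re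
  homog : ∀ p ∈ D, ∀ lam : ℂ, lam ≠ 0 →
    L (p.1, lam • p.2) = ((Complex.normSq lam : ℝ) : ℂ) * L p
  hermitian : ∀ p ∈ D, ∀ i j, (starRingEnd ℂ) (gm L i j p) = gm L j i p
  posdef : ∀ p ∈ D, ∀ v : Fin n → ℂ, v ≠ 0 →
    0 < (∑ i, ∑ j, gm L i j p * v i * (starRingEnd ℂ) (v j)).re

variable (L : Pt n → ℂ)

/-- The metric tensor as a matrix at a point. -/
def gmat (p : Pt n) : Matrix (Fin n) (Fin n) ℂ := fun i j => gm L i j p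

/-- The inverse metric tensor `g^{l̄ i}`. -/
def gi (l i : Fin n) (p : Pt n) : ℂ := (gmat L p)⁻¹ l i

/-- The Chern–Finsler nonlinear connection coefficients
`N^i_k := g^{m̄ i} (∂g_{l m̄}/∂z^k) η^l`. -/
def Nc (i k : Fin n) (p : Pt n) : ℂ :=
  ∑ m, ∑ l, gi L m i p * dz (gm L l m) k p * p.2 l

/-- The horizontal derivation `δ_k := ∂/∂z^k − N^j_k ∂/∂η^j`. -/
def del (f : Pt n → ℂ) (k : Fin n) (p : Pt n) : ℂ :=
  dz f k p - ∑ j, Nc L j k p * de f j p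

/-- The conjugate horizontal derivation `δ_k̄ := ∂/∂z̄^k − N̄^j_k ∂/∂η̄^j`. -/
def delbar (f : Pt n → ℂ) (k : Fin n) (p : Pt n) : ℂ :=
  dzbar f k p - ∑ j, (starRingEnd ℂ) (Nc L j k p) * debar f j p

/-- The horizontal Chern–Finsler connection coefficients `L^i_{jk} := g^{l̄ i} δ_k(g_{j l̄})`. -/
def Lc (i j k : Fin n) (p : Pt n) : ℂ := ∑ l, gi L l i p * del L (gm L j l) k p

/-- The vertical Chern–Finsler connection coefficients `C^i_{jk} := g^{l̄ i} ∂g_{j l̄}/∂η^k`. -/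
def Cc (i j k : Fin n) (p : Pt n) : ℂ := ∑ l, gi L l i p * de (gm L j l) k p

/-- The spray coefficients `G^i := ½ N^i_j η^j`. -/
def Gs (i : Fin n) (p : Pt n) : ℂ := (1 / 2) * ∑ j, Nc L i j p * p.2 j

/-- The canonical horizontal derivation `δ̊_k := ∂/∂z^k − (∂G^j/∂η^k) ∂/∂η^j`. -/
def delc (f : Pt n → ℂ) (k : Fin n) (p : Pt n) : ℂ :=
  dz f k p - ∑ j, de (Gs L j) k p * de f j p

/-- `F := √L`. -/
def Fh (p : Pt n) : ℂ := (Real.sqrt ((L p).re) : ℂ)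

/-- `l^i := η^i / F`. -/
def lup (i : Fin n) (p : Pt n) : ℂ := p.2 i / Fh L p

/-- `l_i := g_{i j̄} η̄^j / F`. -/
def llow (i : Fin n) (p : Pt n) : ℂ :=
  (∑ j, gm L i j p * (starRingEnd ℂ) (p.2 j)) / Fh L p

/-- `√g` where `g := det(g_{i j̄})`. -/
def sg (p : Pt n) : ℂ := (Real.sqrt ((gmat L p).det.re) : ℂ)

/-- The metric is Kähler. -/
def IsKahler (D : Set (Pt n)) : Prop := ∀ p ∈ D, ∀ i j k, Lc L i j k p = Lc L i k j p

/-- The metric is weakly Kähler. -/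
def IsWeaklyKahler (D : Set (Pt n)) : Prop :=
  ∀ p ∈ D, ∀ k, (∑ i, ∑ j, ∑ l, gm L i l p * (Lc L i j k p - Lc L i k j p) *
    p.2 j * (starRingEnd ℂ) (p.2 l)) = 0

/-- The metric is purely Hermitian: `g_{i j̄}` does not depend on the fibre variable. -/
def IsPurelyHermitian (D : Set (Pt n)) : Prop :=
  ∀ p ∈ D, ∀ i j k, de (gm L i j) k p = 0 ∧ debar (gm L i j) k p = 0

/-- The metric is a complex Berwald metric: Kähler with `L^i_{jk}` independent of the
fibre variable. -/
def IsBerwald (D : Set (Pt n)) : Prop :=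
  IsKahler L D ∧ ∀ p ∈ D, ∀ i j k l, de (Lc L i j k) l p = 0 ∧ debar (Lc L i j k) l p = 0

/-- The metric is a complex Landsberg metric: the Berwald and Rund connections coincide. -/
def IsLandsberg (D : Set (Pt n)) : Prop :=
  ∀ p ∈ D, ∀ i j k, de (de (Gs L i) k) j p =
    (1 / 2) * ∑ l, gi L l i p * (delc L (gm L j l) k p + delc L (gm L k l) j p)

/-- `m^i` of the local complex Berwald frame: `m¹ = −l₂/√g`, `m² = l₁/√g`. -/
def mup (L : Pt 2 → ℂ) (i : Fin 2) (p : Pt 2) : ℂ :=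
  if i = 0 then -(llow L 1 p) / sg L p else llow L 0 p / sg L p

/-- `m_i := g_{i j̄} m̄^j`. -/
def mlow (L : Pt 2 → ℂ) (i : Fin 2) (p : Pt 2) : ℂ :=
  ∑ j, gm L i j p * (starRingEnd ℂ) (mup L j p)

/-- `A := m^j m^k l_h C^h_{kj}`. -/
def sA (L : Pt 2 → ℂ) (p : Pt 2) : ℂ :=
  ∑ j, ∑ k, ∑ h, mup L j p * mup L k p * llow L h p * Cc L h k j p

/-- `B := m_h m^k m^j C^h_{jk}`. -/
def sB (L : Pt 2 → ℂ) (p : Pt 2) : ℂ :=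
  ∑ j, ∑ k, ∑ h, mlow L h p * mup L k p * mup L j p * Cc L h j k p

/-- `J := l^j l^k l_i L^i_{jk}`. -/
def sJ (L : Pt 2 → ℂ) (p : Pt 2) : ℂ :=
  ∑ j, ∑ k, ∑ i, lup L j p * lup L k p * llow L i p * Lc L i j k p

/-- `U := m^j l^k l_i L^i_{jk}`. -/
def sU (L : Pt 2 → ℂ) (p : Pt 2) : ℂ :=
  ∑ j, ∑ k, ∑ i, mup L j p * lup L k p * llow L i p * Lc L i j k p

/-- `V := l^j m^k l_i L^i_{jk}`. -/
def sV (L : Pt 2 → ℂ) (p : Pt 2) : ℂ :=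
  ∑ j, ∑ k, ∑ i, lup L j p * mup L k p * llow L i p * Lc L i j k p

/-- `X := m^j m^k l_i L^i_{jk}`. -/
def sX (L : Pt 2 → ℂ) (p : Pt 2) : ℂ :=
  ∑ j, ∑ k, ∑ i, mup L j p * mup L k p * llow L i p * Lc L i j k p

/-- `O := l^j l^k m_i L^i_{jk}`. -/
def sO (L : Pt 2 → ℂ) (p : Pt 2) : ℂ :=
  ∑ j, ∑ k, ∑ i, lup L j p * lup L k p * mlow L i p * Lc L i j k p

/-- `Y := m^j l^k m_i L^i_{jk}`. -/
def sY (L : Pt 2 → ℂ) (p : Pt 2) : ℂ :=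
  ∑ j, ∑ k, ∑ i, mup L j p * lup L k p * mlow L i p * Lc L i j k p

/-- `E := l^j m^k m_i L^i_{jk}`. -/
def sE (L : Pt 2 → ℂ) (p : Pt 2) : ℂ :=
  ∑ j, ∑ k, ∑ i, lup L j p * mup L k p * mlow L i p * Lc L i j k p

/-- `H := m^j m^k m_i L^i_{jk}`. -/
def sH (L : Pt 2 → ℂ) (p : Pt 2) : ℂ :=
  ∑ j, ∑ k, ∑ i, mup L j p * mup L k p * mlow L i p * Lc L i j k p

/-- The vertical curvature invariant `I := −(∂B/∂η̄^s) m̄^s − B B̄/2`. -/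
def vI (L : Pt 2 → ℂ) (p : Pt 2) : ℂ :=
  -(∑ s, debar (sB L) s p * (starRingEnd ℂ) (mup L s p)) -
    sB L p * (starRingEnd ℂ) (sB L p) / 2

/-- The `v v̄`-Riemann type tensor `S_{r̄ j h̄ k} := −g_{i r̄} ∂C^i_{jk}/∂η̄^h`. -/
def Sv (L : Pt 2 → ℂ) (r j h k : Fin 2) (p : Pt 2) : ℂ :=
  -∑ i, gm L i r p * debar (Cc L i j k) h p

/-- The `h h̄`-Riemann type tensor
`R_{r̄ j h̄ k} := g_{i r̄} (−δ_h̄(L^i_{jk}) − δ_h̄(N^l_k) C^i_{jl})`. -/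
def Rh (L : Pt 2 → ℂ) (r j h k : Fin 2) (p : Pt 2) : ℂ :=
  ∑ i, gm L i r p *
    (-(delbar L (Lc L i j k) h p) - ∑ l, delbar L (Nc L l k) h p * Cc L i j l p)

/-- The horizontal curvature invariant `K := −(1/F) δ_k̄(J) η̄^k`. -/
def hK (L : Pt 2 → ℂ) (p : Pt 2) : ℂ :=
  -(1 / Fh L p) * ∑ k, delbar L (sJ L) k p * (starRingEnd ℂ) (p.2 k)

/-- The horizontal curvature invariant
`W := −δ_s̄(H) m̄^s − ½ H (V̄+H̄) − B F δ_s̄(E) m̄^s`. -/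
def hW (L : Pt 2 → ℂ) (p : Pt 2) : ℂ :=
  -(∑ s, delbar L (sH L) s p * (starRingEnd ℂ) (mup L s p)) -
    (1 / 2) * sH L p * ((starRingEnd ℂ) (sV L p) + (starRingEnd ℂ) (sH L p)) -
    sB L p * Fh L p * ∑ s, delbar L (sE L) s p * (starRingEnd ℂ) (mup L s p)

/-- The weak symmetry condition `R_{0̄ k 0̄ 0} = R_{0̄ 0 0̄ k}`, i.e.
`R_{r̄ k h̄ s} η̄^r η̄^h η^s = R_{r̄ s h̄ k} η̄^r η^s η̄^h`. -/
def WeakSym (L : Pt 2 → ℂ) (D : Set (Pt 2)) : Prop :=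
  ∀ p ∈ D, ∀ k,
    (∑ r, ∑ h, ∑ s, Rh L r k h s p * (starRingEnd ℂ) (p.2 r) *
      (starRingEnd ℂ) (p.2 h) * p.2 s) =
    ∑ r, ∑ s, ∑ h, Rh L r s h k p * (starRingEnd ℂ) (p.2 r) * p.2 s *
      (starRingEnd ℂ) (p.2 h)

/-! ### Wirtinger operators as linear functionals of the derivative -/

/-- The functional `φ ↦ ½ (φ v + a φ w)`; all Wirtinger derivatives are of this form. -/
def wirt (a : ℂ) (v w : Pt n) : (Pt n →L[ℝ] ℂ) →ₗ[ℂ] ℂ where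
  toFun φ := (1 / 2) * (φ v + a * φ w)
  map_add' φ ψ := by simp only [add_apply]; ring
  map_smul' b φ := by simp only [_root_.smul_apply, smul_eq_mul, RingHom.id_apply]; ring

theorem wirt_apply (a : ℂ) (v w : Pt n) (φ : Pt n →L[ℝ] ℂ) :
    wirt a v w φ = (1 / 2) * (φ v + a * φ w) := rfl

theorem dz_eq_wirt (f : Pt n → ℂ) (k : Fin n) (p : Pt n) :
    dz f k p = wirt (-I) (Pi.single k 1, 0) (Pi.single k I, 0) (fderiv ℝ f p) := by
  rw [dz, wirt_apply]; ring

theorem dzbar_eq_wirt (f : Pt n → ℂ) (k : Fin n) (p : Pt n) :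
    dzbar f k p = wirt I (Pi.single k 1, 0) (Pi.single k I, 0) (fderiv ℝ f p) := rfl

theorem de_eq_wirt (f : Pt n → ℂ) (k : Fin n) (p : Pt n) :
    de f k p = wirt (-I) (0, Pi.single k 1) (0, Pi.single k I) (fderiv ℝ f p) := by
  rw [de, wirt_apply]; ring

theorem debar_eq_wirt (f : Pt n → ℂ) (k : Fin n) (p : Pt n) :
    debar f k p = wirt I (0, Pi.single k 1) (0, Pi.single k I) (fderiv ℝ f p) := rfl

/-- The functional with `delbar L f k p = delbarFun L k p (fderiv ℝ f p)`. -/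
def delbarFun (k : Fin n) (p : Pt n) : (Pt n →L[ℝ] ℂ) →ₗ[ℂ] ℂ :=
  wirt I (Pi.single k 1, 0) (Pi.single k I, 0) -
    ∑ j, (starRingEnd ℂ) (Nc L j k p) • wirt I (0, Pi.single j 1) (0, Pi.single j I)

theorem delbar_eq_delbarFun (f : Pt n → ℂ) (k : Fin n) (p : Pt n) :
    delbar L f k p = delbarFun L k p (fderiv ℝ f p) := by
  simp [delbar, delbarFun, dzbar_eq_wirt, debar_eq_wirt, LinearMap.sum_apply]

theorem map_fderiv_mul (Φ : (Pt n →L[ℝ] ℂ) →ₗ[ℂ] ℂ) {f g : Pt n → ℂ} {p : Pt n}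
    (hf : DifferentiableAt ℝ f p) (hg : DifferentiableAt ℝ g p) :
    Φ (fderiv ℝ (fun q => f q * g q) p) = f p * Φ (fderiv ℝ g p) + g p * Φ (fderiv ℝ f p) := by
  rw [fderiv_fun_mul hf hg, map_add, map_smul, map_smul, smul_eq_mul, smul_eq_mul]

theorem map_fderiv_sum (Φ : (Pt n →L[ℝ] ℂ) →ₗ[ℂ] ℂ) {ι : Type*} [Fintype ι]
    {f : ι → Pt n → ℂ} {p : Pt n} (hf : ∀ i, DifferentiableAt ℝ (f i) p) :
    Φ (fderiv ℝ (fun q => ∑ i, f i q) p) = ∑ i, Φ (fderiv ℝ (f i) p) := by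
  rw [fderiv_fun_sum fun i _ => hf i, map_sum]

section Smooth

variable {D : Set (Pt n)} {f : Pt n → ℂ}

theorem differentiableAt_of_contDiffOn (hD : IsOpen D) (hf : ContDiffOn ℝ (⊤ : ℕ∞) f D)
    {p : Pt n} (hp : p ∈ D) : DifferentiableAt ℝ f p :=
  (hf.differentiableOn (by simp)).differentiableAt (hD.mem_nhds hp)

theorem contDiffOn_wirt (hD : IsOpen D) (hf : ContDiffOn ℝ (⊤ : ℕ∞) f D) (a : ℂ) (v w : Pt n) :
    ContDiffOn ℝ (⊤ : ℕ∞) (fun p => wirt a v w (fderiv ℝ f p)) D := by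
  have h : ContDiffOn ℝ (⊤ : ℕ∞) (fderiv ℝ f) D := hf.fderiv_of_isOpen hD (by simp)
  simp only [wirt_apply]
  exact contDiffOn_const.mul ((h.clm_apply contDiffOn_const).add
    (contDiffOn_const.mul (h.clm_apply contDiffOn_const)))

theorem contDiffOn_dz (hD : IsOpen D) (hf : ContDiffOn ℝ (⊤ : ℕ∞) f D) (k : Fin n) :
    ContDiffOn ℝ (⊤ : ℕ∞) (dz f k) D :=
  (contDiffOn_wirt hD hf _ _ _).congr fun p _ => dz_eq_wirt f k p

theorem contDiffOn_de (hD : IsOpen D) (hf : ContDiffOn ℝ (⊤ : ℕ∞) f D) (k : Fin n) :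
    ContDiffOn ℝ (⊤ : ℕ∞) (de f k) D :=
  (contDiffOn_wirt hD hf _ _ _).congr fun p _ => de_eq_wirt f k p

theorem contDiffOn_debar (hD : IsOpen D) (hf : ContDiffOn ℝ (⊤ : ℕ∞) f D) (k : Fin n) :
    ContDiffOn ℝ (⊤ : ℕ∞) (debar f k) D :=
  (contDiffOn_wirt hD hf _ _ _).congr fun p _ => debar_eq_wirt f k p

theorem wirt_comm (hD : IsOpen D) (hf : ContDiffOn ℝ (⊤ : ℕ∞) f D) {p : Pt n} (hp : p ∈ D)
    (a b : ℂ) (v w v' w' : Pt n) :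
    wirt a v w (fderiv ℝ (fun q => wirt b v' w' (fderiv ℝ f q)) p) =
      wirt b v' w' (fderiv ℝ (fun q => wirt a v w (fderiv ℝ f q)) p) := by
  have h : DifferentiableAt ℝ (fderiv ℝ f) p :=
    ((hf.fderiv_of_isOpen hD (m := (⊤ : ℕ∞)) (by simp)).differentiableOn
      (by simp)).differentiableAt (hD.mem_nhds hp)
  have key (c : ℂ) (u u' x : Pt n) : fderiv ℝ (fun q => wirt c u u' (fderiv ℝ f q)) p x =
      wirt c u u' (fderiv ℝ (fderiv ℝ f) p x) := by
    have hu (y : Pt n) : HasFDerivAt (fun q => fderiv ℝ f q y)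
        ((fderiv ℝ (fderiv ℝ f) p).flip y) p := by
      simpa using h.hasFDerivAt.clm_apply (hasFDerivAt_const y p)
    have := (((hu u).add ((hu u').const_mul c)).const_mul (1 / 2))
    simp only [wirt_apply]
    erw [this.fderiv]
    simp
    ring
  have hsymm : IsSymmSndFDerivAt ℝ f p :=
    (hf.contDiffAt (hD.mem_nhds hp)).isSymmSndFDerivAt (by
      rw [minSmoothness_of_isRCLikeNormedField]; exact WithTop.coe_le_coe.2 le_top)
  rw [wirt_apply, wirt_apply b, key, key, key, key]
  simp only [wirt_apply]
  rw [hsymm.eq v v', hsymm.eq v w', hsymm.eq w v', hsymm.eq w w']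
  ring

theorem dzbar_dz_comm (hD : IsOpen D) (hf : ContDiffOn ℝ (⊤ : ℕ∞) f D) {p : Pt n} (hp : p ∈ D)
    (h k : Fin n) : dzbar (dz f k) h p = dz (dzbar f h) k p := by
  have h1 : dz f k = fun q => wirt (-I) (Pi.single k 1, 0) (Pi.single k I, 0) (fderiv ℝ f q) :=
    funext fun q => dz_eq_wirt f k q
  have h2 : dzbar f h = fun q => wirt I (Pi.single h 1, 0) (Pi.single h I, 0) (fderiv ℝ f q) :=
    funext fun q => dzbar_eq_wirt f h q
  rw [h1, h2, dz_eq_wirt, dzbar_eq_wirt]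
  exact wirt_comm hD hf hp _ _ _ _ _ _

end Smooth

theorem fderiv_conj_apply (f : Pt n → ℂ) (p v : Pt n) :
    fderiv ℝ (fun q => (starRingEnd ℂ) (f q)) p v = (starRingEnd ℂ) (fderiv ℝ f p v) := by
  have := conjCLE.comp_fderiv (f := f) (x := p)
  exact DFunLike.congr_fun this v

theorem dzbar_conj (f : Pt n → ℂ) (k : Fin n) (p : Pt n) :
    dzbar (fun q => (starRingEnd ℂ) (f q)) k p = (starRingEnd ℂ) (dz f k p) := by
  simp only [dz, dzbar, fderiv_conj_apply, map_mul, map_sub, map_div₀, map_one, map_ofNat, conj_I]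
  ring

theorem dz_conj (f : Pt n → ℂ) (k : Fin n) (p : Pt n) :
    dz (fun q => (starRingEnd ℂ) (f q)) k p = (starRingEnd ℂ) (dzbar f k p) := by
  simp only [dz, dzbar, fderiv_conj_apply, map_mul, map_add, map_div₀, map_one, map_ofNat, conj_I]
  ring

theorem fderiv_fibre_coord (j : Fin n) (p v : Pt n) :
    fderiv ℝ (fun q : Pt n => q.2 j) p v = v.2 j := by
  exact congrArg (fun φ : Pt n →L[ℝ] ℂ => φ v)
    ((ContinuousLinearMap.proj (R := ℝ) (φ := fun _ : Fin n => ℂ) j).comp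
      (ContinuousLinearMap.snd ℝ (Fin n → ℂ) (Fin n → ℂ))).fderiv

theorem differentiable_fibre_coord (j : Fin n) : Differentiable ℝ fun q : Pt n => q.2 j := by
  fun_prop

theorem differentiable_conj_fibre_coord (j : Fin n) :
    Differentiable ℝ fun q : Pt n => (starRingEnd ℂ) (q.2 j) :=
  conjCLE.differentiable.comp (differentiable_fibre_coord j)

theorem delbar_fibre_coord (j k : Fin n) (p : Pt n) :
    delbar L (fun q => q.2 j) k p = 0 := by
  have h (i : Fin n) : debar (fun q : Pt n => q.2 j) i p = 0 := by
    by_cases hij : j = i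
    · subst hij; simp [debar, fderiv_fibre_coord]
    · simp [debar, fderiv_fibre_coord, hij]
  simp [delbar, h, dzbar, fderiv_fibre_coord]

theorem delbar_conj_fibre_coord (j k : Fin n) (p : Pt n) :
    delbar L (fun q => (starRingEnd ℂ) (q.2 j)) k p = -(starRingEnd ℂ) (Nc L j k p) := by
  have h (i : Fin n) : debar (fun q : Pt n => (starRingEnd ℂ) (q.2 j)) i p =
      if i = j then 1 else 0 := by
    by_cases hij : j = i
    · subst hij; simp [debar, fderiv_conj_apply, fderiv_fibre_coord]; norm_num
    · simp [debar, fderiv_conj_apply, fderiv_fibre_coord, hij, Ne.symm hij]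
  simp [delbar, h, dzbar, fderiv_conj_apply, fderiv_fibre_coord]

theorem de_conj_fibre_coord (j k : Fin n) (p : Pt n) :
    de (fun q => (starRingEnd ℂ) (q.2 j)) k p = 0 := by
  by_cases hij : j = k
  · subst hij; simp [de, fderiv_conj_apply, fderiv_fibre_coord]
  · simp [de, fderiv_conj_apply, fderiv_fibre_coord, hij]

theorem fderiv_congr_on {D : Set (Pt n)} (hD : IsOpen D) {f g : Pt n → ℂ}
    (h : ∀ q ∈ D, f q = g q) {p : Pt n} (hp : p ∈ D) : fderiv ℝ f p = fderiv ℝ g p :=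
  Filter.EventuallyEq.fderiv_eq (Filter.eventuallyEq_of_mem (hD.mem_nhds hp) h)

theorem eq_sum_re_im_single (v : Fin n → ℂ) : v = ∑ k, ((v k).re • (Pi.single k 1 : Fin n → ℂ) +
    (v k).im • (Pi.single k I : Fin n → ℂ)) := by
  ext i
  simp [Finset.sum_apply, Pi.single_apply, Finset.sum_add_distrib, Complex.re_add_im]

theorem fderiv_fibre_eq_sum (f : Pt n → ℂ) (p : Pt n) (v : Fin n → ℂ) :
    fderiv ℝ f p (0, v) = ∑ k, ((v k).re * fderiv ℝ f p (0, (Pi.single k 1 : Fin n → ℂ)) +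
      (v k).im * fderiv ℝ f p (0, (Pi.single k I : Fin n → ℂ))) := by
  conv_lhs => rw [eq_sum_re_im_single v]
  have : ((0, ∑ k, ((v k).re • (Pi.single k 1 : Fin n → ℂ) +
      (v k).im • (Pi.single k I : Fin n → ℂ))) : Pt n) =
      ContinuousLinearMap.inr ℝ (Fin n → ℂ) (Fin n → ℂ) (∑ k, ((v k).re •
        (Pi.single k 1 : Fin n → ℂ) + (v k).im • (Pi.single k I : Fin n → ℂ))) := rfl
  rw [this, ← ContinuousLinearMap.comp_apply]
  simp only [map_sum, map_add, map_smul, Complex.real_smul]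
  rfl

/-- In the fibre directions the derivative is `∑ (vᵏ ∂/∂ηᵏ + v̄ᵏ ∂/∂η̄ᵏ)`. -/
theorem fderiv_fibre_eq (f : Pt n → ℂ) (p : Pt n) (v : Fin n → ℂ) :
    fderiv ℝ f p (0, v) =
      ∑ k, (v k * de f k p + (starRingEnd ℂ) (v k) * debar f k p) := by
  rw [fderiv_fibre_eq_sum]
  refine Finset.sum_congr rfl fun k _ => ?_
  have h1 : v k = (v k).re + (v k).im * I := (Complex.re_add_im _).symm
  have h2 : (starRingEnd ℂ) (v k) = (v k).re - (v k).im * I := by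
    apply Complex.ext <;> simp
  rw [h2]
  nth_rewrite 3 [h1]
  simp only [de, debar]
  linear_combination (v k).im * fderiv ℝ f p (0, (Pi.single k I : Fin n → ℂ)) * Complex.I_sq

/-! ### Euler identities for a complex Finsler metric -/

namespace IsCFM

variable {L} {D : Set (Pt n)}

theorem contDiffOn_gm (hL : IsCFM n D L) (i j : Fin n) :
    ContDiffOn ℝ (⊤ : ℕ∞) (gm L i j) D :=
  contDiffOn_de hL.openD (contDiffOn_debar hL.openD hL.smooth j) i

theorem differentiableAt_gm (hL : IsCFM n D L) (i j : Fin n) {p : Pt n} (hp : p ∈ D) :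
    DifferentiableAt ℝ (gm L i j) p :=
  differentiableAt_of_contDiffOn hL.openD (hL.contDiffOn_gm i j) hp

theorem differentiableAt_dz_gm (hL : IsCFM n D L) (i j k : Fin n) {p : Pt n} (hp : p ∈ D) :
    DifferentiableAt ℝ (dz (gm L i j) k) p :=
  differentiableAt_of_contDiffOn hL.openD (contDiffOn_dz hL.openD (hL.contDiffOn_gm i j) k) hp

theorem differentiableAt (hL : IsCFM n D L) {p : Pt n} (hp : p ∈ D) : DifferentiableAt ℝ L p :=
  differentiableAt_of_contDiffOn hL.openD hL.smooth hp

theorem fderiv_fibre_smul (hL : IsCFM n D L) {p : Pt n} (hp : p ∈ D) (u : ℂ) :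
    fderiv ℝ L p (0, u • p.2) = 2 * u.re * L p := by
  have hc : HasDerivAt (fun t : ℝ => ((p.1, (1 + t • u) • p.2) : Pt n)) (0, u • p.2) 0 := by
    have h1 : HasDerivAt (fun t : ℝ => (1 + t • u) • p.2) (u • p.2) 0 := by
      have h2 : HasDerivAt (fun t : ℝ => 1 + t • u) u 0 := by
        simpa using ((hasDerivAt_id (0 : ℝ)).smul_const u).const_add 1
      exact h2.smul_const p.2
    exact (hasDerivAt_const (0 : ℝ) p.1).prodMk h1
  have h0 : ((p.1, (1 + (0 : ℝ) • u) • p.2) : Pt n) = p := by simp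
  have hLd : HasFDerivAt L (fderiv ℝ L p) ((p.1, (1 + (0 : ℝ) • u) • p.2) : Pt n) := by
    rw [h0]; exact (hL.differentiableAt hp).hasFDerivAt
  have hcomp := hLd.comp_hasDerivAt (0 : ℝ) hc
  have hev : (L ∘ fun t : ℝ => ((p.1, (1 + t • u) • p.2) : Pt n)) =ᶠ[nhds 0]
      fun t : ℝ => ((Complex.normSq (1 + t • u) : ℝ) : ℂ) * L p := by
    have hcont : ContinuousAt (fun t : ℝ => 1 + t • u) 0 := by fun_prop
    have hne : ∀ᶠ t : ℝ in nhds 0, 1 + t • u ≠ 0 := hcont.eventually_ne (by simp)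
    filter_upwards [hne] with t ht using hL.homog p hp _ ht
  have hns : HasDerivAt (fun t : ℝ => ((Complex.normSq (1 + t • u) : ℝ) : ℂ) * L p)
      (2 * u.re * L p) 0 := by
    have h3 : (fun t : ℝ => Complex.normSq (1 + t • u)) =
        fun t : ℝ => (1 + t * u.re) * (1 + t * u.re) + (t * u.im) * (t * u.im) := by
      funext t; simp [Complex.normSq_apply]
    have h4 : HasDerivAt (fun t : ℝ => Complex.normSq (1 + t • u)) (2 * u.re) 0 := by
      rw [h3]
      have a := ((hasDerivAt_id (0 : ℝ)).mul_const u.re).const_add 1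
      have b := (hasDerivAt_id (0 : ℝ)).mul_const u.im
      exact ((a.mul a).add (b.mul b)).congr_deriv (by simp; ring)
    have h5 := (h4.ofReal_comp).mul_const (L p)
    simpa using h5
  exact (hcomp.congr_of_eventuallyEq hev.symm).unique hns

theorem sum_fibre_de (hL : IsCFM n D L) {p : Pt n} (hp : p ∈ D) :
    ∑ k, p.2 k * de L k p = L p := by
  have h1 := hL.fderiv_fibre_smul hp 1
  have h2 := hL.fderiv_fibre_smul hp I
  rw [fderiv_fibre_eq, Finset.sum_add_distrib] at h1 h2
  simp only [Pi.smul_apply, smul_eq_mul, map_mul, conj_I, one_re, I_re, one_mul,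
    mul_assoc, ← Finset.mul_sum] at h1 h2
  push_cast at h1 h2
  linear_combination (1 / 2) * h1 - (I / 2) * h2 + (1 / 2) * (∑ k, p.2 k * de L k p -
    ∑ k, (starRingEnd ℂ) (p.2 k) * debar L k p) * Complex.I_sq

theorem sum_conj_fibre_debar (hL : IsCFM n D L) {p : Pt n} (hp : p ∈ D) :
    ∑ k, (starRingEnd ℂ) (p.2 k) * debar L k p = L p := by
  have h1 := hL.fderiv_fibre_smul hp 1
  rw [fderiv_fibre_eq, Finset.sum_add_distrib] at h1
  simp only [one_smul, hL.sum_fibre_de hp] at h1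
  simp only [one_re] at h1
  push_cast at h1
  linear_combination h1

theorem sum_gm_conj_fibre (hL : IsCFM n D L) {p : Pt n} (hp : p ∈ D) (i : Fin n) :
    ∑ j, gm L i j p * (starRingEnd ℂ) (p.2 j) = de L i p := by
  have hd (j : Fin n) : DifferentiableAt ℝ (debar L j) p :=
    differentiableAt_of_contDiffOn hL.openD (contDiffOn_debar hL.openD hL.smooth j) hp
  have hc (j : Fin n) := (differentiable_conj_fibre_coord (n := n) j) p
  have h := fderiv_congr_on hL.openD
    (f := fun q => ∑ k, (starRingEnd ℂ) (q.2 k) * debar L k q)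
    (fun q hq => hL.sum_conj_fibre_debar hq) hp
  rw [de_eq_wirt L, ← h, map_fderiv_sum _
    (f := fun k q => (starRingEnd ℂ) (q.2 k) * debar L k q) fun j => (hc j).mul (hd j)]
  refine Finset.sum_congr rfl fun j _ => ?_
  rw [map_fderiv_mul _ (hc j) (hd j), ← de_eq_wirt, ← de_eq_wirt, de_conj_fibre_coord]
  simp only [gm]; ring

theorem sum_gm_fibre (hL : IsCFM n D L) {p : Pt n} (hp : p ∈ D) :
    ∑ i, ∑ j, gm L i j p * p.2 i * (starRingEnd ℂ) (p.2 j) = L p := by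
  rw [← hL.sum_fibre_de hp]
  refine Finset.sum_congr rfl fun i _ => ?_
  rw [← hL.sum_gm_conj_fibre hp, Finset.mul_sum]
  exact Finset.sum_congr rfl fun j _ => by ring

theorem conj_dz_gm (hL : IsCFM n D L) {p : Pt n} (hp : p ∈ D) (i j k : Fin n) :
    (starRingEnd ℂ) (dz (gm L i j) k p) = dzbar (gm L j i) k p := by
  rw [← dzbar_conj, dzbar_eq_wirt, dzbar_eq_wirt,
    fderiv_congr_on hL.openD (fun q hq => hL.hermitian q hq i j) hp]

end IsCFM

/-! ### Two-dimensional linear algebra of the metric tensor -/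

namespace IsCFM

variable {L : Pt 2 → ℂ} {D : Set (Pt 2)}

theorem det_gmat (L : Pt 2 → ℂ) (p : Pt 2) :
    (gmat L p).det = gm L 0 0 p * gm L 1 1 p - gm L 0 1 p * gm L 1 0 p := by
  rw [Matrix.det_fin_two]; rfl

theorem det_gmat_im (hL : IsCFM 2 D L) {p : Pt 2} (hp : p ∈ D) : (gmat L p).det.im = 0 := by
  rw [← Complex.conj_eq_iff_im, det_gmat]
  simp only [map_sub, map_mul, hL.hermitian p hp]
  ring

theorem det_gmat_re_pos (hL : IsCFM 2 D L) {p : Pt 2} (hp : p ∈ D) :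
    0 < (gmat L p).det.re := by
  have h00 : (gm L 0 0 p).im = 0 := Complex.conj_eq_iff_im.1 (hL.hermitian p hp 0 0)
  have hpos : 0 < (gm L 0 0 p).re := by
    have h := hL.posdef p hp ![1, 0] (fun h => by simpa using congrFun h 0)
    simpa [Fin.sum_univ_two] using h
  have h := hL.posdef p hp ![-gm L 1 0 p, gm L 0 0 p] (fun h => by
    have h1 := congrFun h 1
    simp only [Matrix.cons_val_one, Matrix.cons_val_fin_one, Pi.zero_apply] at h1
    rw [h1] at hpos
    simp at hpos)
  have key : (∑ i, ∑ j, gm L i j p * (![-gm L 1 0 p, gm L 0 0 p] : Fin 2 → ℂ) i *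
      (starRingEnd ℂ) ((![-gm L 1 0 p, gm L 0 0 p] : Fin 2 → ℂ) j)) =
      gm L 0 0 p * (gmat L p).det := by
    simp only [Fin.sum_univ_two, Matrix.cons_val_zero, Matrix.cons_val_one,
      Matrix.cons_val_fin_one, map_neg, hL.hermitian p hp, det_gmat]
    ring
  rw [key, Complex.mul_re, h00, zero_mul, sub_zero] at h
  exact pos_of_mul_pos_right h hpos.le

theorem det_gmat_ne_zero (hL : IsCFM 2 D L) {p : Pt 2} (hp : p ∈ D) : (gmat L p).det ≠ 0 :=
  fun h => by simpa [h] using hL.det_gmat_re_pos hp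

theorem gi_eq (L : Pt 2 → ℂ) (l i : Fin 2) (p : Pt 2) :
    gi L l i p = (gmat L p).det⁻¹ * (gmat L p).adjugate l i := by
  rw [gi, Matrix.inv_def, Ring.inverse_eq_inv']; rfl

theorem sum_gi_gm (hL : IsCFM 2 D L) {p : Pt 2} (hp : p ∈ D) (l r : Fin 2) :
    ∑ i, gi L l i p * gm L i r p = if l = r then 1 else 0 := by
  have h := Matrix.nonsing_inv_mul (gmat L p) (isUnit_iff_ne_zero.2 (hL.det_gmat_ne_zero hp))
  have h2 := congrFun (congrFun h l) r
  rw [Matrix.mul_apply, Matrix.one_apply] at h2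
  exact h2

theorem differentiableAt_gi (hL : IsCFM 2 D L) {p : Pt 2} (hp : p ∈ D) (l i : Fin 2) :
    DifferentiableAt ℝ (gi L l i) p := by
  have hg (i j : Fin 2) := hL.differentiableAt_gm i j hp
  have hdet : DifferentiableAt ℝ (fun q => (gmat L q).det⁻¹) p := by
    have : DifferentiableAt ℝ (fun q => (gmat L q).det) p := by
      simp only [det_gmat]
      exact ((hg 0 0).mul (hg 1 1)).sub ((hg 0 1).mul (hg 1 0))
    exact this.inv (hL.det_gmat_ne_zero hp)
  have hadj : DifferentiableAt ℝ (fun q => (gmat L q).adjugate l i) p := by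
    simp only [Matrix.adjugate_fin_two, gmat]
    fin_cases l <;> fin_cases i
    · exact hg 1 1
    · exact (hg 0 1).neg
    · exact (hg 1 0).neg
    · exact hg 0 0
  rw [funext (gi_eq L l i)]
  exact hdet.mul hadj

theorem Lc_eq (hpH : IsPurelyHermitian L D) {p : Pt 2} (hp : p ∈ D) (i j k : Fin 2) :
    Lc L i j k p = ∑ l, gi L l i p * dz (gm L j l) k p := by
  simp [Lc, del, (hpH p hp _ _ _).1]

theorem differentiableAt_Lc (hpH : IsPurelyHermitian L D)
    (hL : IsCFM 2 D L) {p : Pt 2} (hp : p ∈ D) (i j k : Fin 2) :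
    DifferentiableAt ℝ (Lc L i j k) p := by
  have h : DifferentiableAt ℝ (fun q => ∑ l, gi L l i q * dz (gm L j l) k q) p :=
    DifferentiableAt.fun_sum fun l _ =>
      (hL.differentiableAt_gi hp l i).mul (hL.differentiableAt_dz_gm j l k hp)
  exact h.congr_of_eventuallyEq
    (Filter.eventuallyEq_of_mem (hL.openD.mem_nhds hp) fun q hq => Lc_eq hpH hq i j k)

theorem sum_gm_Lc (hpH : IsPurelyHermitian L D)
    (hL : IsCFM 2 D L) {p : Pt 2} (hp : p ∈ D) (r j k : Fin 2) :
    ∑ i, gm L i r p * Lc L i j k p = dz (gm L j r) k p := by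
  have h0 := hL.sum_gi_gm hp 0 r
  have h1 := hL.sum_gi_gm hp 1 r
  simp only [Lc_eq hpH hp, Fin.sum_univ_two] at *
  fin_cases r
  · simp at h0 h1 ⊢
    linear_combination dz (gm L j 0) k p * h0 + dz (gm L j 1) k p * h1
  · simp at h0 h1 ⊢
    linear_combination dz (gm L j 0) k p * h0 + dz (gm L j 1) k p * h1

theorem Nc_eq (hpH : IsPurelyHermitian L D) {p : Pt 2} (hp : p ∈ D) (i k : Fin 2) :
    Nc L i k p = ∑ l, Lc L i l k p * p.2 l := by
  simp only [Nc, Lc_eq hpH hp, Fin.sum_univ_two]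
  ring

theorem delbar_gm (hpH : IsPurelyHermitian L D)
    (hL : IsCFM 2 D L) {p : Pt 2} (hp : p ∈ D) (i j h : Fin 2) :
    delbar L (gm L i j) h p = (starRingEnd ℂ) (dz (gm L j i) h p) := by
  simp [delbar, (hpH p hp _ _ _).2, hL.conj_dz_gm hp]

theorem conj_dz_gm_eq_sum (hpH : IsPurelyHermitian L D)
    (hL : IsCFM 2 D L) {p : Pt 2} (hp : p ∈ D) (i r h : Fin 2) :
    (starRingEnd ℂ) (dz (gm L r i) h p) =
      ∑ s, gm L i s p * (starRingEnd ℂ) (Lc L s r h p) := by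
  rw [← sum_gm_Lc hpH hL hp, map_sum]
  simp only [map_mul, hL.hermitian p hp]

theorem delbar_dz_gm (hpH : IsPurelyHermitian L D)
    (hL : IsCFM 2 D L) {p : Pt 2} (hp : p ∈ D) (j r k h : Fin 2) :
    delbar L (dz (gm L j r) k) h p = dzbar (dz (gm L j r) k) h p := by
  have h0 (l : Fin 2) : debar (dz (gm L j r) k) l p = 0 := by
    have h1 : dz (gm L j r) k = fun q => wirt (-I) (Pi.single k 1, 0) (Pi.single k I, 0)
        (fderiv ℝ (gm L j r) q) := funext fun q => dz_eq_wirt _ k q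
    rw [h1, debar_eq_wirt, wirt_comm hL.openD (hL.contDiffOn_gm j r) hp,
      fderiv_congr_on hL.openD
        (f := fun q => wirt I (0, Pi.single l 1) (0, Pi.single l I) (fderiv ℝ (gm L j r) q))
        (g := fun _ => 0) (fun q hq => (hpH q hq j r l).2) hp]
    simp
  simp [delbar, h0]

theorem delbar_self (hpH : IsPurelyHermitian L D)
    (hL : IsCFM 2 D L) {p : Pt 2} (hp : p ∈ D) (h : Fin 2) :
    delbar L L h p = 0 := by
  have e (i : Fin 2) := differentiable_fibre_coord i p
  have ec (i : Fin 2) := differentiable_conj_fibre_coord i p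
  have g (i j : Fin 2) := hL.differentiableAt_gm i j hp
  rw [delbar_eq_delbarFun, ← fderiv_congr_on hL.openD
    (f := fun q => ∑ i, ∑ j, gm L i j q * q.2 i * (starRingEnd ℂ) (q.2 j))
    (fun q hq => hL.sum_gm_fibre hq) hp,
    map_fderiv_sum _ (f := fun i q => ∑ j, gm L i j q * q.2 i * (starRingEnd ℂ) (q.2 j))
      fun i => DifferentiableAt.fun_sum fun j _ => ((g i j).mul (e i)).mul (ec j)]
  refine Finset.sum_eq_zero fun i _ => ?_
  rw [map_fderiv_sum _ (f := fun j q => gm L i j q * q.2 i * (starRingEnd ℂ) (q.2 j))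
      fun j => ((g i j).mul (e i)).mul (ec j)]
  have term (j : Fin 2) : delbarFun L h p (fderiv ℝ
      (fun q => gm L i j q * q.2 i * (starRingEnd ℂ) (q.2 j)) p) =
      p.2 i * ((starRingEnd ℂ) (p.2 j) * ∑ s, gm L i s p * (starRingEnd ℂ) (Lc L s j h p) -
        gm L i j p * ∑ l, (starRingEnd ℂ) (Lc L j l h p) * (starRingEnd ℂ) (p.2 l)) := by
    rw [map_fderiv_mul _ (f := fun q => gm L i j q * q.2 i) ((g i j).mul (e i)) (ec j),
      map_fderiv_mul _ (g i j) (e i)]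
    simp only [← delbar_eq_delbarFun, delbar_fibre_coord, delbar_conj_fibre_coord,
      delbar_gm hpH hL hp, conj_dz_gm_eq_sum hpH hL hp, Nc_eq hpH hp, map_sum, map_mul]
    ring
  simp only [term, Fin.sum_univ_two]
  ring

theorem Rh_eq (hpH : IsPurelyHermitian L D)
    (hL : IsCFM 2 D L) {p : Pt 2} (hp : p ∈ D) (r j h k : Fin 2) :
    Rh L r j h k p = -dzbar (dz (gm L j r) k) h p +
      ∑ i, ∑ s, gm L i s p * (starRingEnd ℂ) (Lc L s r h p) * Lc L i j k p := by
  have hC (i j k : Fin 2) : Cc L i j k p = 0 := by simp [Cc, (hpH p hp _ _ _).1]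
  have hg (i : Fin 2) := hL.differentiableAt_gm i r hp
  have hl (i : Fin 2) := differentiableAt_Lc hpH hL hp i j k
  rw [← delbar_dz_gm hpH hL hp, delbar_eq_delbarFun,
    ← fderiv_congr_on hL.openD (f := fun q => ∑ i, gm L i r q * Lc L i j k q)
    (fun q hq => sum_gm_Lc hpH hL hq r j k) hp,
    map_fderiv_sum _ (f := fun i q => gm L i r q * Lc L i j k q)
      fun i => (hg i).mul (hl i)]
  simp only [map_fderiv_mul _ (hg _) (hl _), ← delbar_eq_delbarFun, delbar_gm hpH hL hp,
    conj_dz_gm_eq_sum hpH hL hp, Rh, hC, Fin.sum_univ_two]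
  ring

theorem sJ_mul_Fh_pow (hpH : IsPurelyHermitian L D)
    (hL : IsCFM 2 D L) {p : Pt 2} (hp : p ∈ D) (hF : Fh L p ≠ 0) :
    Fh L p ^ 3 * sJ L p = ∑ j, ∑ k, ∑ r,
      p.2 j * p.2 k * (starRingEnd ℂ) (p.2 r) * dz (gm L j r) k p := by
  simp only [← sum_gm_Lc hpH hL hp, sJ, lup, llow, Fin.sum_univ_two]
  field_simp
  ring

end IsCFM

/-! ### The curvature invariant and the symmetries of the curvature tensor -/

namespace IsCFM

variable {L : Pt 2 → ℂ} {D : Set (Pt 2)}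

theorem Fh_sq (hL : IsCFM 2 D L) {p : Pt 2} (hp : p ∈ D) : Fh L p ^ 2 = L p := by
  rw [Fh, ← Complex.ofReal_pow, Real.sq_sqrt (hL.pos p hp).le]
  apply Complex.ext <;> simp [hL.real_im p hp]

theorem L_ne_zero (hL : IsCFM 2 D L) {p : Pt 2} (hp : p ∈ D) : L p ≠ 0 :=
  fun h => by simpa [h] using hL.pos p hp

theorem Fh_ne_zero (hL : IsCFM 2 D L) {p : Pt 2} (hp : p ∈ D) : Fh L p ≠ 0 :=
  fun h => hL.L_ne_zero hp (by rw [← hL.Fh_sq hp, h]; simp)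

theorem conj_Fh (L : Pt 2 → ℂ) (p : Pt 2) : (starRingEnd ℂ) (Fh L p) = Fh L p :=
  Complex.conj_ofReal _

theorem differentiableAt_Fh (hL : IsCFM 2 D L) {p : Pt 2} (hp : p ∈ D) :
    DifferentiableAt ℝ (Fh L) p := by
  have h1 : DifferentiableAt ℝ (fun q => (L q).re) p :=
    Complex.reCLM.differentiableAt.comp p (hL.differentiableAt hp)
  exact Complex.ofRealCLM.differentiableAt.comp p (h1.sqrt (hL.pos p hp).ne')

theorem conj_dzbar_dz_gm (hL : IsCFM 2 D L) {p : Pt 2} (hp : p ∈ D)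
    (j r k h : Fin 2) :
    (starRingEnd ℂ) (dzbar (dz (gm L j r) k) h p) = dzbar (dz (gm L r j) h) k p := by
  rw [← dz_conj, dzbar_dz_comm hL.openD (hL.contDiffOn_gm r j) hp, dz_eq_wirt, dz_eq_wirt,
    fderiv_congr_on hL.openD (fun q hq => hL.conj_dz_gm hq j r k) hp]

theorem delbar_Fh (hpH : IsPurelyHermitian L D)
    (hL : IsCFM 2 D L) {p : Pt 2} (hp : p ∈ D) (h : Fin 2) :
    delbar L (Fh L) h p = 0 := by
  have hd := hL.differentiableAt_Fh hp
  have h1 := delbar_self hpH hL hp h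
  rw [delbar_eq_delbarFun, ← fderiv_congr_on hL.openD (f := fun q => Fh L q * Fh L q)
    (fun q hq => by rw [← hL.Fh_sq hq, sq]) hp, map_fderiv_mul _ hd hd,
    ← delbar_eq_delbarFun, ← two_mul] at h1
  simpa [hL.Fh_ne_zero hp] using h1

theorem delbar_sJ (hpH : IsPurelyHermitian L D)
    (hL : IsCFM 2 D L) {p : Pt 2} (hp : p ∈ D) (h : Fin 2) :
    Fh L p ^ 3 * delbar L (sJ L) h p =
      -∑ j, ∑ k, ∑ r, Rh L r j h k p * p.2 j * p.2 k * (starRingEnd ℂ) (p.2 r) := by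
  have e (i : Fin 2) := differentiable_fibre_coord i p
  have ec (i : Fin 2) := differentiable_conj_fibre_coord i p
  have hA (i j k : Fin 2) := hL.differentiableAt_dz_gm i j k hp
  have hF := hL.differentiableAt_Fh hp
  have hl (i : Fin 2) : DifferentiableAt ℝ (lup L i) p :=
    (e i).mul (hF.inv (hL.Fh_ne_zero hp))
  have hll (i : Fin 2) : DifferentiableAt ℝ (llow L i) p :=
    (DifferentiableAt.fun_sum fun j _ => (hL.differentiableAt_gm i j hp).mul (ec j)).mul
      (hF.inv (hL.Fh_ne_zero hp))
  have hJ : DifferentiableAt ℝ (sJ L) p :=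
    DifferentiableAt.fun_sum fun j _ => DifferentiableAt.fun_sum fun k _ =>
      DifferentiableAt.fun_sum fun i _ =>
        (((hl j).mul (hl k)).mul (hll i)).mul (differentiableAt_Lc hpH hL hp i j k)
  have hF3 : delbarFun L h p (fderiv ℝ (fun q => Fh L q * (Fh L q * Fh L q)) p) = 0 := by
    rw [map_fderiv_mul _ (g := fun q => Fh L q * Fh L q) hF (hF.mul hF), map_fderiv_mul _ hF hF, ← delbar_eq_delbarFun,
      delbar_Fh hpH hL hp]
    simp
  have lhs : delbarFun L h p (fderiv ℝ (fun q => Fh L q * (Fh L q * Fh L q) * sJ L q) p) =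
      Fh L p ^ 3 * delbar L (sJ L) h p := by
    rw [map_fderiv_mul _ (f := fun q => Fh L q * (Fh L q * Fh L q)) (hF.mul (hF.mul hF)) hJ,
      hF3, ← delbar_eq_delbarFun]
    ring
  rw [← lhs, fderiv_congr_on hL.openD (g := fun q => ∑ j, ∑ k, ∑ r,
      q.2 j * q.2 k * (starRingEnd ℂ) (q.2 r) * dz (gm L j r) k q)
      (fun q hq => by rw [← sJ_mul_Fh_pow hpH hL hq (hL.Fh_ne_zero hq)]; ring) hp]
  have hterm (j k r : Fin 2) : DifferentiableAt ℝ (fun q : Pt 2 =>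
      q.2 j * q.2 k * (starRingEnd ℂ) (q.2 r) * dz (gm L j r) k q) p :=
    (((e j).mul (e k)).mul (ec r)).mul (hA j r k)
  rw [map_fderiv_sum _ (f := fun j q => ∑ k, ∑ r,
      q.2 j * q.2 k * (starRingEnd ℂ) (q.2 r) * dz (gm L j r) k q) fun j =>
      DifferentiableAt.fun_sum fun k _ => DifferentiableAt.fun_sum fun r _ => hterm j k r,
    ← Finset.sum_neg_distrib]
  refine Finset.sum_congr rfl fun j _ => ?_
  rw [map_fderiv_sum _ (f := fun k q => ∑ r,
      q.2 j * q.2 k * (starRingEnd ℂ) (q.2 r) * dz (gm L j r) k q) fun k =>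
      DifferentiableAt.fun_sum fun r _ => hterm j k r, ← Finset.sum_neg_distrib]
  refine Finset.sum_congr rfl fun k _ => ?_
  rw [map_fderiv_sum _ (f := fun r q =>
      q.2 j * q.2 k * (starRingEnd ℂ) (q.2 r) * dz (gm L j r) k q) fun r => hterm j k r]
  have term (r : Fin 2) : delbarFun L h p (fderiv ℝ (fun q =>
      q.2 j * q.2 k * (starRingEnd ℂ) (q.2 r) * dz (gm L j r) k q) p) =
      p.2 j * p.2 k * ((starRingEnd ℂ) (p.2 r) * dzbar (dz (gm L j r) k) h p -
        (∑ l, (starRingEnd ℂ) (Lc L r l h p) * (starRingEnd ℂ) (p.2 l)) *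
          ∑ i, gm L i r p * Lc L i j k p) := by
    rw [map_fderiv_mul _ (f := fun q => q.2 j * q.2 k * (starRingEnd ℂ) (q.2 r))
        (((e j).mul (e k)).mul (ec r)) (hA j r k),
      map_fderiv_mul _ (f := fun q => q.2 j * q.2 k) ((e j).mul (e k)) (ec r),
      map_fderiv_mul _ (e j) (e k)]
    simp only [← delbar_eq_delbarFun, delbar_fibre_coord, delbar_conj_fibre_coord,
      delbar_dz_gm hpH hL hp, sum_gm_Lc hpH hL hp, Nc_eq hpH hp, map_sum, map_mul]
    ring
  simp only [term, Rh_eq hpH hL hp, Fin.sum_univ_two]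
  ring

theorem hK_mul_sq (hpH : IsPurelyHermitian L D)
    (hL : IsCFM 2 D L) {p : Pt 2} (hp : p ∈ D) :
    hK L p * L p ^ 2 = ∑ r, ∑ j, ∑ h, ∑ k, Rh L r j h k p * (starRingEnd ℂ) (p.2 r) *
      p.2 j * (starRingEnd ℂ) (p.2 h) * p.2 k := by
  have hF := hL.Fh_ne_zero hp
  have h0 := delbar_sJ hpH hL hp 0
  have h1 := delbar_sJ hpH hL hp 1
  have e : hK L p * L p ^ 2 = -∑ h, Fh L p ^ 3 * delbar L (sJ L) h p *
      (starRingEnd ℂ) (p.2 h) := by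
    rw [← hL.Fh_sq hp, hK]
    simp only [Fin.sum_univ_two]
    field_simp
  rw [e]
  simp only [delbar_sJ hpH hL hp, Fin.sum_univ_two]
  ring

theorem dz_gm_symm (hpH : IsPurelyHermitian L D)
    (hL : IsCFM 2 D L) (hKah : IsKahler L D) {p : Pt 2} (hp : p ∈ D)
    (j r k : Fin 2) : dz (gm L j r) k p = dz (gm L k r) j p := by
  simp only [← sum_gm_Lc hpH hL hp, hKah p hp _ j k]

theorem dzbar_dz_gm_symm (hpH : IsPurelyHermitian L D)
    (hL : IsCFM 2 D L) (hKah : IsKahler L D) {p : Pt 2} (hp : p ∈ D)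
    (j r k h : Fin 2) : dzbar (dz (gm L j r) k) h p = dzbar (dz (gm L k r) j) h p := by
  rw [dzbar_eq_wirt, dzbar_eq_wirt,
    fderiv_congr_on hL.openD (fun q hq => dz_gm_symm hpH hL hKah hq j r k) hp]

theorem Rh_symm (hpH : IsPurelyHermitian L D)
    (hL : IsCFM 2 D L) (hKah : IsKahler L D) {p : Pt 2} (hp : p ∈ D)
    (r j h k : Fin 2) : Rh L r j h k p = Rh L r k h j p := by
  simp only [Rh_eq hpH hL hp, dzbar_dz_gm_symm hpH hL hKah hp j r k, hKah p hp _ j k]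

theorem Rh_symm_bar (hpH : IsPurelyHermitian L D)
    (hL : IsCFM 2 D L) (hKah : IsKahler L D) {p : Pt 2} (hp : p ∈ D)
    (r j h k : Fin 2) : Rh L r j h k p = Rh L h j r k p := by
  have : dzbar (dz (gm L j r) k) h p = dzbar (dz (gm L j h) k) r p := by
    apply (starRingEnd ℂ).injective
    rw [conj_dzbar_dz_gm hL hp, conj_dzbar_dz_gm hL hp, dzbar_dz_gm_symm hpH hL hKah hp]
  simp only [Rh_eq hpH hL hp, this, hKah p hp _ r h]

end IsCFM

/-! ### Vanishing of biquadratic Hermitian forms -/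

open Polynomial in
/-- A real-polynomial identity of biquadratic type on a neighbourhood holds everywhere. -/
theorem biquadratic_eq_zero_of_nhds (T : Fin n → Fin n → Fin n → Fin n → ℂ) {x₀ : Fin n → ℂ}
    {V : Set (Fin n → ℂ)} (hV : V ∈ nhds x₀)
    (hT : ∀ x ∈ V, ∑ r, ∑ j, ∑ h, ∑ k, T r j h k * (starRingEnd ℂ) (x r) * x j *
      (starRingEnd ℂ) (x h) * x k = 0) (x : Fin n → ℂ) :
    ∑ r, ∑ j, ∑ h, ∑ k, T r j h k * (starRingEnd ℂ) (x r) * x j *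
      (starRingEnd ℂ) (x h) * x k = 0 := by
  let a (i : Fin n) : ℂ[X] := C (x₀ i) + X * C (x i - x₀ i)
  let b (i : Fin n) : ℂ[X] :=
    C ((starRingEnd ℂ) (x₀ i)) + X * C ((starRingEnd ℂ) (x i) - (starRingEnd ℂ) (x₀ i))
  let P : ℂ[X] := ∑ r, ∑ j, ∑ h, ∑ k, C (T r j h k) * b r * a j * b h * a k
  have heval (s : ℝ) : P.eval (s : ℂ) = ∑ r, ∑ j, ∑ h, ∑ k, T r j h k *
      (starRingEnd ℂ) ((x₀ + s • (x - x₀)) r) * (x₀ + s • (x - x₀)) j *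
      (starRingEnd ℂ) ((x₀ + s • (x - x₀)) h) * (x₀ + s • (x - x₀)) k := by
    simp [P, a, b, eval_finsetSum]
  have hS : {s : ℝ | x₀ + s • (x - x₀) ∈ V} ∈ nhds (0 : ℝ) := by
    have hc : Continuous fun s : ℝ => x₀ + s • (x - x₀) := by fun_prop
    exact hc.continuousAt.preimage_mem_nhds (by simpa using hV)
  have hP : P = 0 := by
    refine eq_zero_of_infinite_isRoot P
      (((infinite_of_mem_nhds (0 : ℝ) hS).image Complex.ofReal_injective.injOn).mono ?_)
    rintro _ ⟨s, hs, rfl⟩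
    exact (heval s).trans (hT _ hs)
  have h1 := heval 1
  rw [hP] at h1
  simpa using h1.symm

theorem coeff_eq_zero_of_forall {c₀₀ c₁₀ c₀₁ c₂₀ c₁₁ c₀₂ c₂₁ c₁₂ c₂₂ : ℂ}
    (h : ∀ x y : ℂ, y = (starRingEnd ℂ) x → c₀₀ + c₁₀ * x + c₀₁ * y + c₂₀ * x ^ 2 +
      c₁₁ * (x * y) + c₀₂ * y ^ 2 + c₂₁ * (x ^ 2 * y) + c₁₂ * (x * y ^ 2) +
      c₂₂ * (x ^ 2 * y ^ 2) = 0) :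
    c₀₀ = 0 ∧ c₁₀ = 0 ∧ c₀₁ = 0 ∧ c₂₀ = 0 ∧ c₁₁ = 0 ∧ c₀₂ = 0 ∧ c₂₁ = 0 ∧ c₁₂ = 0 ∧ c₂₂ = 0 := by
  have conj_two : (starRingEnd ℂ) 2 = 2 := map_ofNat _ 2
  have h0 := h 0 0 (by simp)
  have h1 := h 1 1 (by simp)
  have h2 := h (-1) (-1) (by simp)
  have h3 := h 2 2 conj_two.symm
  have h4 := h (-2) (-2) (by simp [conj_two])
  have h5 := h I (-I) (by simp)
  have h6 := h (-I) I (by simp)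
  have h7 := h (2 * I) (-(2 * I)) (by simp [conj_two])
  have h8 := h (-(2 * I)) (2 * I) (by simp [conj_two])
  have h9 := h (1 + I) (1 - I) (by simp [sub_eq_add_neg])
  have hI : I ^ 2 = -1 := Complex.I_sq
  clear h
  have e00 : c₀₀ = 0 := by linear_combination h0
  have e22 : c₂₂ = 0 := by
    linear_combination (1 / 24) * (h3 + h4) - (1 / 6) * (h1 + h2) + (1 / 4) * h0
  subst e00 e22
  have o1 : c₁₀ + c₀₁ = 0 := by linear_combination (2 / 3) * (h1 - h2) - (1 / 12) * (h3 - h4)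
  have o2 : c₂₁ + c₁₂ = 0 := by linear_combination (1 / 12) * (h3 - h4) - (1 / 6) * (h1 - h2)
  have o3 : c₁₀ - c₀₁ = 0 := by grind
  have o4 : c₂₁ - c₁₂ = 0 := by grind
  have e1 : c₁₀ = 0 := by linear_combination (o1 + o3) / 2
  have e2 : c₀₁ = 0 := by linear_combination (o1 - o3) / 2
  have e3 : c₂₁ = 0 := by linear_combination (o2 + o4) / 2
  have e4 : c₁₂ = 0 := by linear_combination (o2 - o4) / 2
  subst e1 e2 e3 e4
  have e5 : c₁₁ = 0 := by
    linear_combination (1 / 2) * (h1 + h5) - (1 / 2) * (c₂₀ + c₀₂ - c₁₁) * hI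
  subst e5
  have e6 : c₂₀ + c₀₂ = 0 := by linear_combination h1
  have e7 : c₂₀ - c₀₂ = 0 := by
    linear_combination (-(I / 2)) * h9 + (c₂₀ - c₀₂ + I / 2 * (c₂₀ + c₀₂)) * hI
  refine ⟨rfl, rfl, rfl, ?_, rfl, ?_, rfl, rfl, rfl⟩
  · linear_combination (e6 + e7) / 2
  · linear_combination (e6 - e7) / 2

theorem biquadratic_coeff_eq_zero (T : Fin 2 → Fin 2 → Fin 2 → Fin 2 → ℂ)
    (hs : ∀ r j h k, T r j h k = T r k h j) (hs' : ∀ r j h k, T r j h k = T h j r k)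
    (hT : ∀ x : Fin 2 → ℂ, ∑ r, ∑ j, ∑ h, ∑ k, T r j h k * (starRingEnd ℂ) (x r) * x j *
      (starRingEnd ℂ) (x h) * x k = 0) (r j h k : Fin 2) : T r j h k = 0 := by
  have key := coeff_eq_zero_of_forall (c₀₀ := T 0 0 0 0) (c₁₀ := 2 * T 0 0 0 1)
    (c₀₁ := 2 * T 0 0 1 0) (c₂₀ := T 0 1 0 1) (c₁₁ := 4 * T 0 0 1 1) (c₀₂ := T 1 0 1 0)
    (c₂₁ := 2 * T 0 1 1 1) (c₁₂ := 2 * T 1 0 1 1) (c₂₂ := T 1 1 1 1) (by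
      rintro x _ rfl
      have h := hT ![1, x]
      simp only [Fin.sum_univ_two, Matrix.cons_val_zero, Matrix.cons_val_one,
        Matrix.cons_val_fin_one, map_one] at h
      rw [hs 0 1 0 0, hs' 1 0 0 0, hs' 1 0 0 1, hs 0 1 1 0, hs' 1 1 0 0, hs 0 1 1 0,
        hs' 1 1 0 1, hs 1 1 1 0] at h
      linear_combination h)
  simp only [mul_eq_zero, OfNat.ofNat_ne_zero, false_or] at key
  obtain ⟨k1, k2, k3, k4, k5, k6, k7, k8, k9⟩ := key
  fin_cases r <;> fin_cases j <;> fin_cases h <;> fin_cases k <;> grind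

/-! ### Fibrewise local constancy -/

/-- `f` does not depend on the fibre variable on the product set `U ×ˢ V`. -/
def FibreConstOn (U V : Set (Fin n → ℂ)) (f : Pt n → ℂ) : Prop :=
  ∀ z ∈ U, ∀ x ∈ V, ∀ y ∈ V, f (z, x) = f (z, y)

namespace FibreConstOn

variable {U V : Set (Fin n → ℂ)} {f : Pt n → ℂ}

theorem fderiv_eq (hU : IsOpen U) (hV : IsOpen V) (hf : FibreConstOn U V f) {z x y : Fin n → ℂ}
    (hz : z ∈ U) (hx : x ∈ V) (hy : y ∈ V) : fderiv ℝ f (z, x) = fderiv ℝ f (z, y) := by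
  have hxy : ((z, x) : Pt n) + (0, y - x) = (z, y) := by simp
  have h := fderiv_comp_add_right (𝕜 := ℝ) (f := f) (x := ((z, x) : Pt n)) (0, y - x)
  rw [hxy] at h
  rw [← h]
  refine Filter.EventuallyEq.fderiv_eq ?_
  have hc : ContinuousAt (fun q : Pt n => q + (0, y - x)) (z, x) := by fun_prop
  have h1 : ∀ᶠ q : Pt n in nhds (z, x), q ∈ U ×ˢ V := (hU.prod hV).mem_nhds ⟨hz, hx⟩
  have h2 : ∀ᶠ q : Pt n in nhds (z, x), q + (0, y - x) ∈ U ×ˢ V :=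
    hc.eventually (by beta_reduce; rw [hxy]; exact (hU.prod hV).mem_nhds ⟨hz, hy⟩)
  filter_upwards [h1, h2] with q hq hq'
  have e : q + (0, y - x) = (q.1, q.2 + (y - x)) := by ext <;> simp
  rw [e] at hq' ⊢
  exact hf q.1 hq.1 q.2 hq.2 _ hq'.2

theorem dz (hU : IsOpen U) (hV : IsOpen V) (hf : FibreConstOn U V f) (k : Fin n) :
    FibreConstOn U V (dz f k) := fun z hz x hx y hy => by
  rw [dz_eq_wirt, dz_eq_wirt, hf.fderiv_eq hU hV hz hx hy]

theorem dzbar (hU : IsOpen U) (hV : IsOpen V) (hf : FibreConstOn U V f) (k : Fin n) :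
    FibreConstOn U V (dzbar f k) := fun z hz x hx y hy => by
  rw [dzbar_eq_wirt, dzbar_eq_wirt, hf.fderiv_eq hU hV hz hx hy]

/-- A function with vanishing fibre derivatives is fibrewise constant over a convex set. -/
theorem of_de_debar_eq_zero (hV : IsOpen V) (hVc : Convex ℝ V)
    (hd : ∀ q ∈ U ×ˢ V, DifferentiableAt ℝ f q)
    (h : ∀ q ∈ U ×ˢ V, ∀ k, de f k q = 0 ∧ debar f k q = 0) : FibreConstOn U V f := by
  intro z hz x hx y hy
  have hcomp (w : Fin n → ℂ) (hw : w ∈ V) : HasFDerivAt (fun w => f (z, w))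
      ((fderiv ℝ f (z, w)).comp (ContinuousLinearMap.inr ℝ (Fin n → ℂ) (Fin n → ℂ))) w :=
    (hd (z, w) ⟨hz, hw⟩).hasFDerivAt.comp w (hasFDerivAt_prodMk_right z w)
  refine hV.is_const_of_fderiv_eq_zero (𝕜 := ℝ) hVc.isPreconnected (f := fun w => f (z, w))
    (fun w hw => (hcomp w hw).differentiableAt.differentiableWithinAt) (fun w hw => ?_) hx hy
  rw [(hcomp w hw).fderiv]
  ext v
  change fderiv ℝ f (z, w) (0, v) = 0
  rw [fderiv_fibre_eq]
  simp [h (z, w) ⟨hz, hw⟩]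

end FibreConstOn

/-! ### Contraction of the space-form tensor with unit vectors -/

theorem sum_spaceForm_contract (g : Fin 2 → Fin 2 → ℂ) (c : ℂ) (v : Fin 2 → ℂ)
    (hv : ∑ i, ∑ j, g i j * v i * (starRingEnd ℂ) (v j) = 1) :
    ∑ r, ∑ j, ∑ h, ∑ k, (c / 2) * (g j r * g k h + g k r * g j h) * (starRingEnd ℂ) (v r) *
      v j * (starRingEnd ℂ) (v h) * v k = c := by
  simp only [Fin.sum_univ_two] at *
  linear_combination c * (g 0 0 * v 0 * (starRingEnd ℂ) (v 0) + g 0 1 * v 0 * (starRingEnd ℂ) (v 1) +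
    (g 1 0 * v 1 * (starRingEnd ℂ) (v 0) + g 1 1 * v 1 * (starRingEnd ℂ) (v 1)) + 1) * hv

namespace IsCFM

variable {L : Pt 2 → ℂ} {D : Set (Pt 2)}

theorem lup_unit (hL : IsCFM 2 D L) {p : Pt 2} (hp : p ∈ D) :
    ∑ i, ∑ j, gm L i j p * lup L i p * (starRingEnd ℂ) (lup L j p) = 1 := by
  have hF := hL.Fh_ne_zero hp
  have h := hL.sum_gm_fibre hp
  rw [← hL.Fh_sq hp] at h
  simp only [lup, map_div₀, conj_Fh, Fin.sum_univ_two] at h ⊢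
  field_simp
  linear_combination h

theorem mup_unit (hL : IsCFM 2 D L) {p : Pt 2} (hp : p ∈ D) :
    ∑ i, ∑ j, gm L i j p * mup L i p * (starRingEnd ℂ) (mup L j p) = 1 := by
  have hF := hL.Fh_ne_zero hp
  have h := hL.sum_gm_fibre hp
  rw [← hL.Fh_sq hp] at h
  have hs : sg L p ^ 2 = (gmat L p).det := by
    rw [sg, ← Complex.ofReal_pow, Real.sq_sqrt (hL.det_gmat_re_pos hp).le]
    apply Complex.ext <;> simp [hL.det_gmat_im hp]
  have hs0 : sg L p ≠ 0 := fun h0 => hL.det_gmat_ne_zero hp (by rw [← hs, h0]; simp)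
  have hsc : (starRingEnd ℂ) (sg L p) = sg L p := Complex.conj_ofReal _
  rw [det_gmat] at hs
  simp only [mup, llow, Fin.sum_univ_two, if_true, one_ne_zero, if_false, map_div₀, map_neg,
    map_add, map_mul, conj_Fh, hsc, hL.hermitian p hp, Complex.conj_conj] at h ⊢
  field_simp
  linear_combination (gm L 0 0 p * gm L 1 1 p - gm L 0 1 p * gm L 1 0 p) * h -
    Fh L p ^ 2 * hs

theorem exists_fibreConst_nhds (hL : IsCFM 2 D L) (hpH : IsPurelyHermitian L D) {p : Pt 2}
    (hp : p ∈ D) : ∃ V ∈ nhds p.2, ∀ x ∈ V, (p.1, x) ∈ D ∧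
      (∀ i j, gm L i j (p.1, x) = gm L i j p) ∧
      ∀ r j h k, Rh L r j h k (p.1, x) = Rh L r j h k p := by
  obtain ⟨ε, hε, hball⟩ := Metric.isOpen_iff.1 hL.openD p hp
  set U := Metric.ball p.1 ε with hUdef
  set V := Metric.ball p.2 ε with hVdef
  have hU : IsOpen U := Metric.isOpen_ball
  have hV : IsOpen V := Metric.isOpen_ball
  have hsub : U ×ˢ V ⊆ D := by rw [hUdef, hVdef, ball_prod_same]; exact hball
  have hz : p.1 ∈ U := Metric.mem_ball_self hε
  have hη : p.2 ∈ V := Metric.mem_ball_self hε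
  have hg (i j : Fin 2) : FibreConstOn U V (gm L i j) :=
    .of_de_debar_eq_zero hV (convex_ball _ _)
      (fun q hq => hL.differentiableAt_gm i j (hsub hq)) fun q hq k => hpH q (hsub hq) i j k
  refine ⟨V, hV.mem_nhds hη, fun x hx => ?_⟩
  have hxD : (p.1, x) ∈ D := hsub ⟨hz, hx⟩
  have hgx (i j : Fin 2) : gm L i j (p.1, x) = gm L i j p := hg i j _ hz x hx p.2 hη
  refine ⟨hxD, hgx, fun r j h k => ?_⟩
  have hmat : gmat L (p.1, x) = gmat L p := by ext i j; exact hgx i j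
  have hgi (l i : Fin 2) : gi L l i (p.1, x) = gi L l i p := by rw [gi, gi, hmat]
  have hA (i j k : Fin 2) : dz (gm L i j) k (p.1, x) = dz (gm L i j) k p :=
    (hg i j).dz hU hV k _ hz x hx p.2 hη
  have hB : dzbar (dz (gm L j r) k) h (p.1, x) = dzbar (dz (gm L j r) k) h p :=
    ((hg j r).dz hU hV k).dzbar hU hV h _ hz x hx p.2 hη
  have hLc (i j k : Fin 2) : Lc L i j k (p.1, x) = Lc L i j k p := by
    simp only [Lc_eq hpH hxD, Lc_eq hpH hp, hgi, hA]
  simp only [Rh_eq hpH hL hxD, Rh_eq hpH hL hp, hB, hLc, hgx]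

theorem Rh_eq_spaceForm (hL : IsCFM 2 D L) (hKah : IsKahler L D) (hpH : IsPurelyHermitian L D)
    {c : ℂ} (hKc : ∀ p ∈ D, hK L p = c) {p : Pt 2} (hp : p ∈ D) (r j h k : Fin 2) :
    Rh L r j h k p =
      (c / 2) * (gm L j r p * gm L k h p + gm L k r p * gm L j h p) := by
  obtain ⟨V, hV, hconst⟩ := exists_fibreConst_nhds hL hpH hp
  rw [← sub_eq_zero]
  refine biquadratic_coeff_eq_zero (fun r j h k => Rh L r j h k p -
    (c / 2) * (gm L j r p * gm L k h p + gm L k r p * gm L j h p))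
    (fun r j h k => ?_) (fun r j h k => ?_)
    (biquadratic_eq_zero_of_nhds _ hV fun x hx => ?_) r j h k
  · rw [Rh_symm hpH hL hKah hp]; ring
  · rw [Rh_symm_bar hpH hL hKah hp]; ring
  · obtain ⟨hxD, hg, hR⟩ := hconst x hx
    have h1 := hK_mul_sq hpH hL hxD
    rw [hKc _ hxD, ← hL.sum_gm_fibre hxD] at h1
    simp only [hg, hR, Fin.sum_univ_two] at h1 ⊢
    linear_combination -h1

end IsCFM


/-- Kähler purely Hermitian with constant `K` gives
`R_{r̄ j h̄ k} = (K/2)(g_{j r̄} g_{k h̄} + g_{k r̄} g_{j h̄})` and both horizontal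
holomorphic sectional curvatures equal `2K`. -/
theorem statement18 (D : Set (Pt 2)) (L : Pt 2 → ℂ) (hL : IsCFM 2 D L)
    (hKah : IsKahler L D) (hpH : IsPurelyHermitian L D)
    (c : ℝ) (hKc : ∀ p ∈ D, hK L p = (c : ℂ)) :
    ∀ p ∈ D,
      (∀ r j h k : Fin 2, Rh L r j h k p =
        ((c : ℂ) / 2) * (gm L j r p * gm L k h p + gm L k r p * gm L j h p)) ∧
      2 * (∑ r, ∑ j, ∑ h, ∑ k, Rh L r j h k p * (starRingEnd ℂ) (lup L r p) *
        lup L j p * (starRingEnd ℂ) (lup L h p) * lup L k p) = 2 * (c : ℂ) ∧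
      2 * (∑ r, ∑ j, ∑ h, ∑ k, Rh L r j h k p * (starRingEnd ℂ) (mup L r p) *
        mup L j p * (starRingEnd ℂ) (mup L h p) * mup L k p) = 2 * (c : ℂ) := by
  intro p hp
  have hR := hL.Rh_eq_spaceForm hKah hpH hKc hp
  refine ⟨hR, ?_, ?_⟩
  · simp only [hR]
    rw [sum_spaceForm_contract (fun i j => gm L i j p) c (fun i => lup L i p) (hL.lup_unit hp)]
  · simp only [hR]
    rw [sum_spaceForm_contract (fun i j => gm L i j p) c (fun i => mup L i p) (hL.mup_unit hp)]

end CFinsler
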